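/- Let α ∈ (0,1) ∪ (1,2), let k be an even integer and l an integer. Then (1/π) ∫_0^π e^{−2ils} · ( ∫_0^π sin(η)^α·(−k²·sin(η) + 2ik·cos(η))·e^{ikη}·|sin(s−η)|^{1−α} dη ) ds = (cot(πα/2)/8)·α·(1−α)·((1−α)k² − 4kl) · Γ((α−1)/2 + |l|)·Γ((−1−α)/2 + |k/2 − l|) / ( Γ((3−α)/2 + |l|)·Γ((3+α)/2 + |k/2 − l|) ), where for each s ∈ (0,π) the inner integral converges absolutely (the exponent 1−α of |sin(s−η)| is greater than −1). -/

import Mathlib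

open MeasureTheory Filter Set Real intervalIntegral

/-- The substitution `u = (1 - cos θ) / 2` turns the integrand of the symmetric Beta integral into
a multiple of `sin θ ^ p`. -/
lemma abs_deriv_smul_beta_integrand (p : ℝ) {θ : ℝ} (hθ : θ ∈ Set.Ioo 0 π) :
    |Real.sin θ / 2| • ((((1 - Real.cos θ) / 2 : ℝ) : ℂ) ^ (((p + 1) / 2 : ℝ) - 1 : ℂ)
      * (1 - (((1 - Real.cos θ) / 2 : ℝ) : ℂ)) ^ (((p + 1) / 2 : ℝ) - 1 : ℂ))
      = ((Real.sin θ ^ p : ℝ) : ℂ) * (((2 : ℝ) ^ p)⁻¹ : ℝ) := by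
  have hs : 0 < Real.sin θ := Real.sin_pos_of_mem_Ioo hθ
  have hc := Real.sin_sq_add_cos_sq θ
  have h1 : 0 < (1 - Real.cos θ) / 2 := by nlinarith [Real.cos_le_one θ]
  have h2 : 0 < 1 - (1 - Real.cos θ) / 2 := by nlinarith [Real.neg_one_le_cos θ]
  have h3 : (1 - Real.cos θ) / 2 * (1 - (1 - Real.cos θ) / 2) = (Real.sin θ / 2) ^ (2 : ℝ) := by
    rw [Real.rpow_two]; linear_combination (-1 / 4 : ℝ) * hc
  have h4 : (1 : ℂ) - (((1 - Real.cos θ) / 2 : ℝ) : ℂ)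
      = ((1 - (1 - Real.cos θ) / 2 : ℝ) : ℂ) := by push_cast; rfl
  have h5 : (((p + 1) / 2 : ℝ) - 1 : ℂ) = (((p + 1) / 2 - 1 : ℝ) : ℂ) := by push_cast; rfl
  rw [h4, h5, ← Complex.ofReal_cpow h1.le, ← Complex.ofReal_cpow h2.le, ← Complex.ofReal_mul,
    ← Real.mul_rpow h1.le h2.le, h3, ← Real.rpow_mul (by positivity), abs_of_pos (by positivity),
    Complex.real_smul, ← Complex.ofReal_mul, ← Complex.ofReal_mul]
  congr 1
  calc Real.sin θ / 2 * (Real.sin θ / 2) ^ (2 * ((p + 1) / 2 - 1))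
      = (Real.sin θ / 2) ^ (1 + 2 * ((p + 1) / 2 - 1)) := by
        rw [Real.rpow_add (by positivity), Real.rpow_one]
    _ = (Real.sin θ / 2) ^ p := by congr 1; ring
    _ = Real.sin θ ^ p * ((2 : ℝ) ^ p)⁻¹ := by
        rw [Real.div_rpow hs.le zero_le_two, div_eq_mul_inv]

lemma image_one_sub_cos_div_two :
    (fun θ : ℝ => (1 - Real.cos θ) / 2) '' Set.Ioo 0 π = Set.Ioo 0 1 := by
  have h : (fun θ : ℝ => (1 - Real.cos θ) / 2) = (fun x : ℝ => (1 - x) / 2) ∘ Real.cos := rfl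
  rw [h, Set.image_comp]
  have hcos : Real.cos '' Set.Ioo 0 π = Set.Ioo (-1) 1 :=
    Real.cosPartialHomeomorph.image_source_eq_target
  rw [hcos]
  ext x
  constructor
  · rintro ⟨y, ⟨h1, h2⟩, rfl⟩
    constructor <;> dsimp only <;> linarith
  · rintro ⟨h1, h2⟩
    exact ⟨1 - 2 * x, ⟨by linarith, by linarith⟩, by ring⟩

lemma hasDerivAt_one_sub_cos_div_two (θ : ℝ) :
    HasDerivAt (fun θ : ℝ => (1 - Real.cos θ) / 2) (Real.sin θ / 2) θ := by
  simpa using ((Real.hasDerivAt_cos θ).const_sub 1).div_const 2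

lemma injOn_one_sub_cos_div_two :
    Set.InjOn (fun θ : ℝ => (1 - Real.cos θ) / 2) (Set.Ioo 0 π) := fun x hx y hy h =>
  Real.injOn_cos (Set.Ioo_subset_Icc_self hx) (Set.Ioo_subset_Icc_self hy) (by
    dsimp only at h; linarith)

lemma intervalIntegrable_sin_rpow {p : ℝ} (hp : -1 < p) :
    IntervalIntegrable (fun η : ℝ => ((Real.sin η ^ p : ℝ) : ℂ)) volume 0 π := by
  have hre : 0 < (((p + 1) / 2 : ℝ) : ℂ).re := by rw [Complex.ofReal_re]; linarith
  have hb := (intervalIntegrable_iff_integrableOn_Ioo_of_le zero_le_one).1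
    (Complex.betaIntegral_convergent hre hre)
  rw [← image_one_sub_cos_div_two, integrableOn_image_iff_integrableOn_abs_deriv_smul
    measurableSet_Ioo (fun θ _ => (hasDerivAt_one_sub_cos_div_two θ).hasDerivWithinAt)
    injOn_one_sub_cos_div_two, integrableOn_congr_fun
      (fun θ hθ => abs_deriv_smul_beta_integrand p hθ) measurableSet_Ioo] at hb
  rw [intervalIntegrable_iff_integrableOn_Ioo_of_le Real.pi_pos.le]
  refine (integrable_mul_const_iff (IsUnit.mk0 _ ?_) _).1 hb
  exact_mod_cast (by positivity : ((2 : ℝ) ^ p)⁻¹ ≠ 0)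

lemma integral_sin_rpow {p : ℝ} (hp : -1 < p) :
    ∫ η in (0 : ℝ)..π, ((Real.sin η ^ p : ℝ) : ℂ)
      = ((√π * Real.Gamma ((p + 1) / 2) / Real.Gamma (p / 2 + 1) : ℝ) : ℂ) := by
  have hre : 0 < (((p + 1) / 2 : ℝ) : ℂ).re := by rw [Complex.ofReal_re]; linarith
  have hb := Complex.betaIntegral_eq_Gamma_mul_div _ _ hre hre
  rw [Complex.betaIntegral, intervalIntegral.integral_of_le zero_le_one, integral_Ioc_eq_integral_Ioo,
    ← image_one_sub_cos_div_two, integral_image_eq_integral_abs_deriv_smul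
    measurableSet_Ioo (fun θ _ => (hasDerivAt_one_sub_cos_div_two θ).hasDerivWithinAt)
    injOn_one_sub_cos_div_two, setIntegral_congr_fun measurableSet_Ioo
      (fun θ hθ => abs_deriv_smul_beta_integrand p hθ), MeasureTheory.integral_mul_const,
    ← integral_Ioc_eq_integral_Ioo, ← intervalIntegral.integral_of_le Real.pi_pos.le,
    ← Complex.ofReal_add, Complex.Gamma_ofReal, Complex.Gamma_ofReal, ← Complex.ofReal_mul,
    ← Complex.ofReal_div] at hb
  have h2 : (0 : ℝ) < 2 ^ p := by positivity
  have hd := Real.Gamma_mul_Gamma_add_half ((p + 1) / 2)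
  have e1 : (p + 1) / 2 + 1 / 2 = p / 2 + 1 := by ring
  have e2 : 2 * ((p + 1) / 2) = p + 1 := by ring
  have e3 : (p + 1) / 2 + (p + 1) / 2 = p + 1 := by ring
  have e4 : 1 - (p + 1) = -p := by ring
  rw [e1, e2, e4, Real.rpow_neg zero_le_two] at hd
  rw [e3] at hb
  have g1 : Real.Gamma (p + 1) ≠ 0 := (Real.Gamma_pos_of_pos (by linarith)).ne'
  have g2 : Real.Gamma (p / 2 + 1) ≠ 0 := (Real.Gamma_pos_of_pos (by linarith)).ne'
  have hc : (((2 : ℝ) ^ p)⁻¹ : ℝ) ≠ (0 : ℂ) := by exact_mod_cast (inv_pos.2 h2).ne'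
  refine mul_right_cancel₀ hc ?_
  rw [hb, ← Complex.ofReal_mul, Complex.ofReal_inj]
  rw [div_eq_iff g1, div_mul_eq_mul_div, div_mul_eq_mul_div, eq_div_iff g2]
  linear_combination Real.Gamma ((p + 1) / 2) * hd

/-- The Fourier coefficient (up to normalisation) of `sin ^ p` on `[0, π]` at the even frequency
`2 * n`. -/
noncomputable def sinRpowFourier (p : ℝ) (n : ℤ) : ℂ :=
  ∫ η in (0 : ℝ)..π, ((Real.sin η ^ p : ℝ) : ℂ) * Complex.exp (2 * Complex.I * n * η)

lemma intervalIntegrable_sin_rpow_mul {p : ℝ} (hp : -1 < p) {g : ℝ → ℂ} (hg : Continuous g) :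
    IntervalIntegrable (fun η : ℝ => ((Real.sin η ^ p : ℝ) : ℂ) * g η) volume 0 π :=
  (intervalIntegrable_sin_rpow hp).mul_continuousOn hg.continuousOn

lemma integral_sin_rpow_mul_deriv {p : ℝ} (hp : -1 < p) (b : ℂ) :
    ∫ η in (0 : ℝ)..π, ((Real.sin η ^ p : ℝ) : ℂ)
      * (((p + 1) * Real.cos η + Complex.I * b * Real.sin η) * Complex.exp (Complex.I * b * η))
      = 0 := by
  have hcont : Continuous fun η : ℝ =>
      ((Real.sin η ^ (p + 1) : ℝ) : ℂ) * Complex.exp (Complex.I * b * η) :=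
    (Complex.continuous_ofReal.comp
      (Real.continuous_sin.rpow_const fun _ => Or.inr (by linarith))).mul (by fun_prop)
  rw [intervalIntegral.integral_eq_sub_of_hasDerivAt_of_le Real.pi_pos.le hcont.continuousOn]
  · rw [Real.sin_pi, Real.sin_zero, Real.zero_rpow (by linarith)]
    simp
  · intro η hη
    have hs : 0 < Real.sin η := Real.sin_pos_of_mem_Ioo hη
    have h1 := ((Real.hasDerivAt_sin η).rpow_const (p := p + 1) (Or.inl hs.ne')).ofReal_comp
    have h2 : HasDerivAt (fun x : ℝ => Complex.exp (Complex.I * b * x))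
        (Complex.exp (Complex.I * b * η) * (Complex.I * b)) η := by
      simpa using (((hasDerivAt_id η).ofReal_comp).const_mul (Complex.I * b)).cexp
    refine (h1.mul h2).congr_deriv ?_
    have h3 : Real.sin η ^ (p + 1) = Real.sin η ^ p * Real.sin η := by
      rw [Real.rpow_add hs, Real.rpow_one]
    rw [h3, add_sub_cancel_right]
    push_cast
    ring
  · exact intervalIntegrable_sin_rpow_mul hp (by fun_prop)

lemma sinRpowFourier_neg (p : ℝ) (n : ℤ) : sinRpowFourier p (-n) = sinRpowFourier p n := by
  have h := intervalIntegral.integral_comp_sub_left (a := 0) (b := π)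
    (fun η : ℝ => ((Real.sin η ^ p : ℝ) : ℂ) * Complex.exp (2 * Complex.I * n * η)) π
  rw [sub_self, sub_zero] at h
  rw [sinRpowFourier, sinRpowFourier, ← h]
  congr 1
  funext η
  have h2 : Complex.exp (2 * Complex.I * n * ((π - η : ℝ) : ℂ))
      = Complex.exp (2 * Complex.I * ((-n : ℤ) : ℂ) * η) := by
    rw [← Complex.exp_periodic.int_mul n (2 * Complex.I * ((-n : ℤ) : ℂ) * η)]
    congr 1
    push_cast
    ring
  rw [Real.sin_pi_sub, h2]

lemma sinRpowFourier_zero {p : ℝ} (hp : -1 < p) :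
    sinRpowFourier p 0
      = ((√π * Real.Gamma ((p + 1) / 2) / Real.Gamma (p / 2 + 1) : ℝ) : ℂ) := by
  simpa [sinRpowFourier] using integral_sin_rpow hp

lemma sinRpowFourier_add_one {p : ℝ} (hp : -1 < p) (n : ℤ) :
    (n + 1 + p / 2) * sinRpowFourier p (n + 1) = (n - p / 2) * sinRpowFourier p n := by
  have h := integral_sin_rpow_mul_deriv hp (2 * n + 1)
  have key : ∀ η : ℝ, ((Real.sin η ^ p : ℝ) : ℂ)
      * (((p + 1) * Real.cos η + Complex.I * (2 * n + 1) * Real.sin η)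
        * Complex.exp (Complex.I * (2 * n + 1) * η))
      = (n + 1 + p / 2) * (((Real.sin η ^ p : ℝ) : ℂ)
          * Complex.exp (2 * Complex.I * (n + 1 : ℤ) * η))
        - (n - p / 2) * (((Real.sin η ^ p : ℝ) : ℂ) * Complex.exp (2 * Complex.I * n * η)) := by
    intro η
    have e1 : Complex.exp (2 * Complex.I * (n + 1 : ℤ) * η)
        = Complex.exp (Complex.I * (2 * n + 1) * η) * Complex.exp (η * Complex.I) := by
      rw [← Complex.exp_add]; congr 1; push_cast; ring
    have e2 : Complex.exp (2 * Complex.I * n * η)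
        = Complex.exp (Complex.I * (2 * n + 1) * η) * Complex.exp (-η * Complex.I) := by
      rw [← Complex.exp_add]; congr 1; ring
    rw [e1, e2, Complex.ofReal_cos, Complex.ofReal_sin, Complex.cos, Complex.sin]
    linear_combination ((Real.sin η ^ p : ℝ) : ℂ) * Complex.exp (Complex.I * (2 * n + 1) * η)
      * (2 * n + 1) / 2 * (Complex.exp (-η * Complex.I) - Complex.exp (η * Complex.I))
      * Complex.I_sq
  simp_rw [key] at h
  rw [intervalIntegral.integral_sub, intervalIntegral.integral_const_mul,
    intervalIntegral.integral_const_mul] at h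
  · exact sub_eq_zero.1 h
  · exact (intervalIntegrable_sin_rpow_mul hp (by fun_prop)).const_mul _
  · exact (intervalIntegrable_sin_rpow_mul hp (by fun_prop)).const_mul _

lemma sinRpowFourier_natCast {p : ℝ} (hp : -1 < p) (hp' : ∀ m : ℕ, p / 2 ≠ m) (n : ℕ) :
    sinRpowFourier p n = ((√π * Real.Gamma ((p + 1) / 2) / Real.Gamma (-p / 2)
      * (Real.Gamma (-p / 2 + n) / Real.Gamma (1 + p / 2 + n)) : ℝ) : ℂ) := by
  induction n with
  | zero =>
    have hg : Real.Gamma (-p / 2) ≠ 0 := Real.Gamma_ne_zero fun m h => hp' m (by linarith)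
    have e : Real.Gamma (1 + p / 2) = Real.Gamma (p / 2 + 1) := by rw [add_comm]
    rw [Nat.cast_zero, sinRpowFourier_zero hp, Complex.ofReal_inj, Nat.cast_zero, add_zero,
      add_zero, e]
    generalize Real.Gamma (-p / 2) = x at hg ⊢
    field_simp
  | succ n ih =>
    have h := sinRpowFourier_add_one hp n
    have hpos : 0 < 1 + p / 2 + n := by
      have : (0 : ℝ) ≤ n := n.cast_nonneg
      linarith
    have hne : -p / 2 + n ≠ 0 := fun h => hp' n (by linarith)
    have e1 : -p / 2 + ((n + 1 : ℕ) : ℝ) = (-p / 2 + n) + 1 := by push_cast; ring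
    have e2 : 1 + p / 2 + ((n + 1 : ℕ) : ℝ) = (1 + p / 2 + n) + 1 := by push_cast; ring
    rw [ih] at h
    rw [e1, e2, Real.Gamma_add_one hne, Real.Gamma_add_one hpos.ne']
    have hc : ((1 + p / 2 + n : ℝ) : ℂ) ≠ 0 := by exact_mod_cast hpos.ne'
    refine mul_left_cancel₀ hc ?_
    have e3 : (((n : ℤ) : ℂ) + 1 + p / 2) = ((1 + p / 2 + n : ℝ) : ℂ) := by push_cast; ring
    have e4 : (((n : ℤ) : ℂ) - p / 2) = ((-p / 2 + n : ℝ) : ℂ) := by push_cast; ring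
    rw [e3, e4] at h
    rw [Nat.cast_succ, h, ← Complex.ofReal_mul, ← Complex.ofReal_mul, Complex.ofReal_inj]
    have hy := hpos.ne'
    generalize Real.Gamma (1 + p / 2 + n) = x
    generalize 1 + p / 2 + (n : ℝ) = y at hy ⊢
    generalize Real.Gamma (-p / 2) = z
    field_simp

lemma sinRpowFourier_eq {p : ℝ} (hp : -1 < p) (hp' : ∀ m : ℕ, p / 2 ≠ m) (n : ℤ) :
    sinRpowFourier p n = ((√π * Real.Gamma ((p + 1) / 2) / Real.Gamma (-p / 2)
      * (Real.Gamma (-p / 2 + |(n : ℝ)|) / Real.Gamma (1 + p / 2 + |(n : ℝ)|)) : ℝ) : ℂ) := by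
  obtain ⟨m, rfl | rfl⟩ := n.eq_nat_or_neg
  · rw [sinRpowFourier_natCast hp hp', Int.cast_natCast, Nat.abs_cast]
  · rw [sinRpowFourier_neg, sinRpowFourier_natCast hp hp', Int.cast_neg, Int.cast_natCast, abs_neg,
      Nat.abs_cast]

/-- The integral over a period of a convolution with a periodic function. -/
lemma integral_integral_mul_comp_sub {T : ℝ} (hT : 0 < T) {f g : ℝ → ℂ} (hf : Continuous f)
    (hg : Function.Periodic g T) (hgi : IntervalIntegrable g volume 0 T) :
    ∫ s in (0 : ℝ)..T, ∫ η in (0 : ℝ)..T, f η * g (s - η)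
      = (∫ η in (0 : ℝ)..T, f η) * ∫ u in (0 : ℝ)..T, g u := by
  have hint : IntegrableOn (Function.uncurry fun s η : ℝ => f η * g (s - η))
      (uIoc 0 T ×ˢ uIoc 0 T) := by
    have h1 : Integrable ((Set.Ioc 0 T).indicator f) volume :=
      (hf.integrableOn_Ioc).integrable_indicator measurableSet_Ioc
    have h2 : Integrable ((Set.Ioc (-T) T).indicator g) volume := by
      rw [integrable_indicator_iff measurableSet_Ioc,
        ← intervalIntegrable_iff_integrableOn_Ioc_of_le (by linarith)]
      exact hg.intervalIntegrable₀ hT.ne' hgi _ _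
    have h3 := h1.convolution_integrand (ContinuousLinearMap.mul ℝ ℂ) h2
    rw [uIoc_of_le hT.le]
    refine (integrableOn_congr_fun ?_ (measurableSet_Ioc.prod measurableSet_Ioc)).1
      (h3.integrableOn (s := Set.Ioc 0 T ×ˢ Set.Ioc 0 T))
    rintro ⟨s, η⟩ ⟨⟨hs, hs'⟩, hη, hη'⟩
    dsimp only at hs hs' hη hη'
    simp [Function.uncurry, Set.indicator_of_mem (show η ∈ Set.Ioc 0 T from ⟨hη, hη'⟩),
      Set.indicator_of_mem (show s - η ∈ Set.Ioc (-T) T from ⟨by linarith, by linarith⟩)]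
  rw [intervalIntegral_intervalIntegral_swap hint, ← intervalIntegral.integral_mul_const]
  congr 1
  funext η
  rw [intervalIntegral.integral_const_mul, intervalIntegral.integral_comp_sub_right]
  congr 1
  have := hg.intervalIntegral_add_eq (0 - η) 0
  rwa [zero_add, zero_sub, neg_add_eq_sub, ← zero_sub] at this

lemma abs_sin_rpow_periodic (q : ℝ) :
    Function.Periodic (fun u : ℝ => ((|Real.sin u| ^ q : ℝ) : ℂ)) π := fun u => by
  simp only [Real.sin_add_pi, abs_neg]

lemma intervalIntegrable_abs_sin_rpow {q : ℝ} (hq : -1 < q) :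
    IntervalIntegrable (fun u : ℝ => ((|Real.sin u| ^ q : ℝ) : ℂ)) volume 0 π := by
  refine (intervalIntegrable_sin_rpow hq).congr fun u hu => ?_
  rw [uIoc_of_le Real.pi_pos.le] at hu
  rw [abs_of_nonneg (Real.sin_nonneg_of_nonneg_of_le_pi hu.1.le hu.2)]

lemma integral_exp_mul_abs_sin_rpow (q : ℝ) (l : ℤ) :
    ∫ u in (0 : ℝ)..π, Complex.exp (-2 * Complex.I * l * u) * ((|Real.sin u| ^ q : ℝ) : ℂ)
      = sinRpowFourier q l := by
  rw [← sinRpowFourier_neg]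
  refine intervalIntegral.integral_congr fun u hu => ?_
  rw [uIcc_of_le Real.pi_pos.le] at hu
  rw [abs_of_nonneg (Real.sin_nonneg_of_nonneg_of_le_pi hu.1 hu.2), mul_comm]
  push_cast
  ring_nf

lemma integral_sin_rpow_mul_cos_mul_exp {p : ℝ} (hp : 0 < p) (n : ℤ) :
    (p + 1) * ∫ η in (0 : ℝ)..π, ((Real.sin η ^ p : ℝ) : ℂ)
      * (Real.cos η * Complex.exp (2 * Complex.I * n * η))
      = -(2 * Complex.I * n * sinRpowFourier (p + 1) n) := by
  have h := integral_sin_rpow_mul_deriv (by linarith : -1 < p) (2 * n)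
  have key : ∀ η ∈ uIcc 0 π, ((Real.sin η ^ p : ℝ) : ℂ)
      * (((p + 1) * Real.cos η + Complex.I * (2 * n) * Real.sin η)
        * Complex.exp (Complex.I * (2 * n) * η))
      = (p + 1) * (((Real.sin η ^ p : ℝ) : ℂ)
          * (Real.cos η * Complex.exp (2 * Complex.I * n * η)))
        + 2 * Complex.I * n * (((Real.sin η ^ (p + 1) : ℝ) : ℂ)
          * Complex.exp (2 * Complex.I * n * η)) := by
    intro η hη
    rw [uIcc_of_le Real.pi_pos.le] at hη
    rw [Real.rpow_add_one' (Real.sin_nonneg_of_nonneg_of_le_pi hη.1 hη.2) (by linarith),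
      show Complex.I * (2 * n) * η = 2 * Complex.I * n * η by ring]
    push_cast
    ring
  rw [intervalIntegral.integral_congr key, intervalIntegral.integral_add,
    intervalIntegral.integral_const_mul, intervalIntegral.integral_const_mul] at h
  · exact eq_neg_of_add_eq_zero_left h
  · exact (intervalIntegrable_sin_rpow_mul (by linarith) (by fun_prop)).const_mul _
  · exact (intervalIntegrable_sin_rpow_mul (by linarith) (by fun_prop)).const_mul _

lemma integral_sin_rpow_mul_sin_cos_mul_exp {p : ℝ} (hp : 0 < p) (n : ℤ) (a b : ℂ) :
    (p + 1) * ∫ η in (0 : ℝ)..π, ((Real.sin η ^ p : ℝ) : ℂ)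
      * (a * Real.sin η + b * Real.cos η) * Complex.exp (2 * Complex.I * n * η)
      = ((p + 1) * a - 2 * Complex.I * n * b) * sinRpowFourier (p + 1) n := by
  have key : ∀ η ∈ uIcc 0 π, ((Real.sin η ^ p : ℝ) : ℂ)
      * (a * Real.sin η + b * Real.cos η) * Complex.exp (2 * Complex.I * n * η)
      = a * (((Real.sin η ^ (p + 1) : ℝ) : ℂ) * Complex.exp (2 * Complex.I * n * η))
        + b * (((Real.sin η ^ p : ℝ) : ℂ)
          * (Real.cos η * Complex.exp (2 * Complex.I * n * η))) := by
    intro η hη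
    rw [uIcc_of_le Real.pi_pos.le] at hη
    rw [Real.rpow_add_one' (Real.sin_nonneg_of_nonneg_of_le_pi hη.1 hη.2) (by linarith)]
    push_cast
    ring
  rw [intervalIntegral.integral_congr key, intervalIntegral.integral_add,
    intervalIntegral.integral_const_mul, intervalIntegral.integral_const_mul, ← sinRpowFourier]
  · linear_combination b * integral_sin_rpow_mul_cos_mul_exp hp n
  · exact (intervalIntegrable_sin_rpow_mul (by linarith) (by fun_prop)).const_mul _
  · exact (intervalIntegrable_sin_rpow_mul (by linarith) (by fun_prop)).const_mul _

lemma half_ne_natCast {p : ℝ} (hp : p < 4) (h0 : p ≠ 0) (h2 : p ≠ 2) (m : ℕ) : p / 2 ≠ m := by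
  intro h
  have hm : (m : ℝ) < 2 := by linarith
  have hm' : m < 2 := by exact_mod_cast hm
  interval_cases m
  · exact h0 (by simpa using h)
  · exact h2 (by push_cast at h; linarith)

lemma Gamma_reflection_quotient {α : ℝ} (h0 : 0 < α) (h2 : α < 2) (h1 : α ≠ 1) :
    Real.Gamma (1 - α / 2) / Real.Gamma ((α - 1) / 2)
      * (Real.Gamma (1 + α / 2) / Real.Gamma ((-1 - α) / 2))
      = Real.cot (π * α / 2) / 8 * (α * (1 - α) * (α + 1)) := by
  have r1 := Real.Gamma_mul_Gamma_one_sub (α / 2)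
  have r2 := Real.Gamma_mul_Gamma_one_sub ((1 + α) / 2)
  have a1 : Real.Gamma (1 + α / 2) = α / 2 * Real.Gamma (α / 2) := by
    rw [add_comm, Real.Gamma_add_one (by positivity)]
  have a2 : Real.Gamma ((1 + α) / 2) = (α - 1) / 2 * Real.Gamma ((α - 1) / 2) := by
    rw [← Real.Gamma_add_one (div_ne_zero (sub_ne_zero.2 h1) two_ne_zero)]
    congr 1; ring
  have a3 : Real.Gamma (1 - (1 + α) / 2) = (-1 - α) / 2 * Real.Gamma ((-1 - α) / 2) := by
    rw [← Real.Gamma_add_one (by linarith)]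
    congr 1; ring
  have s1 : Real.sin (π * (α / 2)) = Real.sin (π * α / 2) := by congr 1; ring
  have s2 : Real.sin (π * ((1 + α) / 2)) = Real.cos (π * α / 2) := by
    rw [← Real.sin_add_pi_div_two]; congr 1; ring
  have hs : Real.sin (π * α / 2) ≠ 0 :=
    (Real.sin_pos_of_pos_of_lt_pi (by positivity) (by nlinarith [Real.pi_pos])).ne'
  have g1 : Real.Gamma ((α - 1) / 2) ≠ 0 := by
    intro h
    rw [h, mul_zero] at a2
    exact (Real.Gamma_pos_of_pos (by linarith)).ne' a2
  have g2 : Real.Gamma ((1 + α) / 2) ≠ 0 := (Real.Gamma_pos_of_pos (by linarith)).ne'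
  have g3 : Real.Gamma ((-1 - α) / 2) ≠ 0 := Real.Gamma_ne_zero fun m hm =>
    half_ne_natCast (p := α + 1) (by linarith) (by linarith) (by contrapose! h1; linarith) m
      (by linarith)
  rw [a3, s2] at r2
  rw [s1] at r1
  have hc : Real.cos (π * α / 2) ≠ 0 := by
    intro h
    rw [h, div_zero] at r2
    have : (-1 - α) / 2 ≠ 0 := by linarith
    exact mul_ne_zero g2 (mul_ne_zero this g3) r2
  rw [a2] at r2
  rw [a1, Real.cot_eq_cos_div_sin]
  rw [eq_div_iff hc] at r2
  rw [eq_div_iff hs] at r1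
  rw [div_mul_div_comm, div_eq_iff (mul_ne_zero g1 g3)]
  refine mul_right_cancel₀ hs ?_
  generalize Real.sin (π * α / 2) = s at hs r1 ⊢
  generalize Real.cos (π * α / 2) = c at r2 ⊢
  have hcs : c / s * s = c := div_mul_cancel₀ c hs
  linear_combination (α / 2) * r1 - (α / 2) * r2 - α * (1 - α) * (α + 1) / 8
    * (Real.Gamma ((α - 1) / 2) * Real.Gamma ((-1 - α) / 2)) * hcs

/-- The Fourier coefficient d_{k,l} for even k (equations (25)–(27) and (34) of the paper). -/
theorem stmt_14 (α : ℝ) (hα : α ∈ Set.Ioo (0:ℝ) 1 ∪ Set.Ioo (1:ℝ) 2)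
    (k : ℤ) (hk : Even k) (l : ℤ) :
    (∀ s ∈ Set.Ioo 0 π,
      IntervalIntegrable (fun η : ℝ =>
          ((Real.sin η ^ α : ℝ) : ℂ)
            * (-(k : ℂ) ^ 2 * (Real.sin η : ℂ) + 2 * Complex.I * (k : ℂ) * (Real.cos η : ℂ))
            * Complex.exp (Complex.I * (k : ℂ) * (η : ℂ))
            * ((|Real.sin (s - η)| ^ (1 - α) : ℝ) : ℂ))
        MeasureTheory.volume 0 π) ∧
    (1 / (π : ℂ)) * ∫ s in (0:ℝ)..π,
        Complex.exp (-2 * Complex.I * (l : ℂ) * (s : ℂ))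
          * ∫ η in (0:ℝ)..π,
              ((Real.sin η ^ α : ℝ) : ℂ)
                * (-(k : ℂ) ^ 2 * (Real.sin η : ℂ) + 2 * Complex.I * (k : ℂ) * (Real.cos η : ℂ))
                * Complex.exp (Complex.I * (k : ℂ) * (η : ℂ))
                * ((|Real.sin (s - η)| ^ (1 - α) : ℝ) : ℂ)
      = ((Real.cot (π * α / 2) / 8
            * (α * (1 - α) * ((1 - α) * (k : ℝ) ^ 2 - 4 * (k : ℝ) * (l : ℝ)))
            * (Real.Gamma ((α - 1) / 2 + |(l : ℝ)|)
                * Real.Gamma ((-1 - α) / 2 + |(k : ℝ) / 2 - (l : ℝ)|)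
              / (Real.Gamma ((3 - α) / 2 + |(l : ℝ)|)
                * Real.Gamma ((3 + α) / 2 + |(k : ℝ) / 2 - (l : ℝ)|))) : ℝ) : ℂ) := by

  have h0 : 0 < α := hα.elim (fun h => h.1) fun h => by linarith [h.1]
  have h2 : α < 2 := hα.elim (fun h => by linarith [h.2]) fun h => h.2
  have h1 : α ≠ 1 := hα.elim (fun h => h.2.ne) fun h => h.1.ne'
  have hq : -1 < 1 - α := by linarith
  have hsin : Continuous fun η : ℝ => ((Real.sin η ^ α : ℝ) : ℂ) :=
    Complex.continuous_ofReal.comp (Real.continuous_sin.rpow_const fun _ => Or.inr h0.le)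
  constructor
  · intro s _
    have hg := ((abs_sin_rpow_periodic (1 - α)).intervalIntegrable₀ Real.pi_ne_zero
      (intervalIntegrable_abs_sin_rpow hq) s (s - π)).comp_sub_left s
    rw [sub_self, sub_sub_cancel] at hg
    exact hg.continuousOn_mul (Continuous.continuousOn (by fun_prop))
  · obtain ⟨m, rfl⟩ := hk
    have hfubini := integral_integral_mul_comp_sub Real.pi_pos
      (f := fun η : ℝ => ((Real.sin η ^ α : ℝ) : ℂ)
        * (-((m + m : ℤ) : ℂ) ^ 2 * Real.sin η + 2 * Complex.I * ((m + m : ℤ) : ℂ) * Real.cos η)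
        * Complex.exp (2 * Complex.I * (m - l : ℤ) * η))
      (g := fun u : ℝ => Complex.exp (-2 * Complex.I * l * u)
        * ((|Real.sin u| ^ (1 - α) : ℝ) : ℂ))
      (by fun_prop)
      (Function.Periodic.mul (fun u => by
        rw [← Complex.exp_periodic.int_mul (-l) (-2 * Complex.I * l * u)]
        congr 1
        push_cast
        ring) (abs_sin_rpow_periodic (1 - α)))
      ((intervalIntegrable_abs_sin_rpow hq).continuousOn_mul
        (Continuous.continuousOn (by fun_prop)))
    rw [integral_exp_mul_abs_sin_rpow, sinRpowFourier_eq hq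
      (half_ne_natCast (by linarith) (sub_ne_zero.2 h1.symm) (by linarith))] at hfubini
    have hcoeff := integral_sin_rpow_mul_sin_cos_mul_exp h0 (m - l) (-((m + m : ℤ) : ℂ) ^ 2)
      (2 * Complex.I * ((m + m : ℤ) : ℂ))
    rw [sinRpowFourier_eq (by linarith) (half_ne_natCast (by linarith) (by linarith)
      (by contrapose! h1; linarith))] at hcoeff
    have hα1 : ((α : ℂ) + 1) ≠ 0 := by
      exact_mod_cast (by linarith : α + 1 ≠ 0)
    have hlhs : ∀ s : ℝ, Complex.exp (-2 * Complex.I * (l : ℂ) * (s : ℂ))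
        * ∫ η in (0:ℝ)..π, ((Real.sin η ^ α : ℝ) : ℂ)
          * (-((m + m : ℤ) : ℂ) ^ 2 * (Real.sin η : ℂ)
            + 2 * Complex.I * ((m + m : ℤ) : ℂ) * (Real.cos η : ℂ))
          * Complex.exp (Complex.I * ((m + m : ℤ) : ℂ) * (η : ℂ))
          * ((|Real.sin (s - η)| ^ (1 - α) : ℝ) : ℂ)
        = ∫ η in (0:ℝ)..π, ((Real.sin η ^ α : ℝ) : ℂ)
          * (-((m + m : ℤ) : ℂ) ^ 2 * Real.sin η + 2 * Complex.I * ((m + m : ℤ) : ℂ) * Real.cos η)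
          * Complex.exp (2 * Complex.I * (m - l : ℤ) * η)
          * (Complex.exp (-2 * Complex.I * l * (s - η : ℝ))
            * ((|Real.sin (s - η)| ^ (1 - α) : ℝ) : ℂ)) := by
      intro s
      rw [← intervalIntegral.integral_const_mul]
      congr 1
      funext η
      have hexp : Complex.exp (-2 * Complex.I * (l : ℂ) * (s : ℂ))
          * Complex.exp (Complex.I * ((m + m : ℤ) : ℂ) * (η : ℂ))
          = Complex.exp (2 * Complex.I * (m - l : ℤ) * η)
            * Complex.exp (-2 * Complex.I * l * (s - η : ℝ)) := by
        rw [← Complex.exp_add, ← Complex.exp_add]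
        congr 1
        push_cast
        ring
      linear_combination ((Real.sin η ^ α : ℝ) : ℂ)
        * (-((m + m : ℤ) : ℂ) ^ 2 * Real.sin η + 2 * Complex.I * ((m + m : ℤ) : ℂ) * Real.cos η)
        * ((|Real.sin (s - η)| ^ (1 - α) : ℝ) : ℂ) * hexp
    simp_rw [hlhs]
    rw [hfubini]
    refine mul_left_cancel₀ hα1 ?_
    rw [mul_left_comm, ← mul_assoc ((α : ℂ) + 1), hcoeff]
    have hΓ := Gamma_reflection_quotient h0 h2 h1
    have e1 : (1 - α + 1) / 2 = 1 - α / 2 := by ring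
    have e2 : -(1 - α) / 2 = (α - 1) / 2 := by ring
    have e3 : 1 + (1 - α) / 2 = (3 - α) / 2 := by ring
    have e4 : (α + 1 + 1) / 2 = 1 + α / 2 := by ring
    have e5 : -(α + 1) / 2 = (-1 - α) / 2 := by ring
    have e6 : 1 + (α + 1) / 2 = (3 + α) / 2 := by ring
    have e7 : (((m + m : ℤ) : ℝ)) / 2 - l = ((m - l : ℤ) : ℝ) := by push_cast; ring
    have hpoly : ((α : ℂ) + 1) * -((m + m : ℤ) : ℂ) ^ 2
        - 2 * Complex.I * ((m - l : ℤ) : ℂ) * (2 * Complex.I * ((m + m : ℤ) : ℂ))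
        = (((1 - α) * ((m + m : ℤ) : ℝ) ^ 2 - 4 * ((m + m : ℤ) : ℝ) * l : ℝ) : ℂ) := by
      push_cast
      linear_combination (-(8 : ℂ) * m * (m - l)) * Complex.I_sq
    rw [hpoly, e1, e2, e3, e4, e5, e6, e7]
    generalize ((1 - α) * ((m + m : ℤ) : ℝ) ^ 2 - 4 * ((m + m : ℤ) : ℝ) * l) = P
    rw [show (α : ℂ) + 1 = ((α + 1 : ℝ) : ℂ) by push_cast; rfl,
      show 1 / (π : ℂ) = ((1 / π : ℝ) : ℂ) by push_cast; rfl]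
    simp only [← Complex.ofReal_mul]
    rw [Complex.ofReal_inj, mul_div_mul_comm]
    have hsq : √π * √π = π := Real.mul_self_sqrt Real.pi_pos.le
    generalize Real.Gamma ((α - 1) / 2 + _) / _ = X
    generalize Real.Gamma ((-1 - α) / 2 + _) / _ = Y
    rw [mul_div_assoc, mul_div_assoc, one_div, inv_mul_eq_iff_eq_mul₀ Real.pi_ne_zero]
    linear_combination P * X * Y * √π * √π * hΓ
      + P * X * Y * (Real.cot (π * α / 2) / 8 * (α * (1 - α) * (α + 1))) * hsq
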